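/- If X ⊂ M is contained in a finite union of Lipschitz submanifolds of dimension q, then ∫_M dist(·, X)^{−p} vol_g < +∞ for every p ∈ [1, n−q). -/

import Mathlib

open MeasureTheory Filter Topology Set
open scoped ENNReal

/-- A bounded set in `ℝ^q` is covered, at each scale `r ≤ 1`, by `O(r^{-q})` balls of radius
`q * r` centred in the set. -/
lemma exists_finset_cover_card_le {q : ℕ} {K : Set (EuclideanSpace ℝ (Fin q))}
    (hK : Bornology.IsBounded K) :
    ∃ A : ℝ, 0 ≤ A ∧ ∀ r : ℝ, 0 < r → r ≤ 1 → ∃ t : Finset (EuclideanSpace ℝ (Fin q)),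
      (↑t ⊆ K) ∧ (t.card : ℝ) * r ^ q ≤ A ∧ ∀ x ∈ K, ∃ c ∈ t, dist x c ≤ q * r := by
  classical
  obtain ⟨R, hR0, hR⟩ := hK.exists_pos_norm_le
  refine ⟨(2 * R + 3) ^ q, by positivity, fun r hr hr1 => ?_⟩
  let cell : EuclideanSpace ℝ (Fin q) → Fin q → ℤ := fun x i => ⌊x i / r⌋
  let T : Finset (Fin q → ℤ) := Fintype.piFinset fun _ => Finset.Icc ⌊-R / r⌋ ⌊R / r⌋
  have hT : ∀ x ∈ K, cell x ∈ T := fun x hx => by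
    simp only [T, cell, Fintype.mem_piFinset, Finset.mem_Icc]
    intro i
    have h : |x i| ≤ R := (PiLp.norm_apply_le x i).trans (hR x hx)
    constructor <;> apply Int.floor_le_floor <;> gcongr <;> linarith [abs_le.1 h]
  have hsel : ∀ v ∈ T.filter (· ∈ cell '' K), ∃ x ∈ K, cell x = v :=
    fun v hv => (Finset.mem_filter.1 hv).2
  choose! pt hptK hpt using hsel
  refine ⟨(T.filter (· ∈ cell '' K)).image pt, ?_, ?_, fun x hx => ?_⟩
  · intro y hy
    obtain ⟨v, hv, rfl⟩ := Finset.mem_image.1 (Finset.mem_coe.1 hy)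
    exact hptK v hv
  · have hcard : ((T.filter (· ∈ cell '' K)).image pt).card ≤ T.card :=
      Finset.card_image_le.trans (Finset.card_filter_le _ _)
    have hTcard : T.card = (⌊R / r⌋ + 1 - ⌊-R / r⌋).toNat ^ q := by
      simp [T, Fintype.card_piFinset]
    have hside : ((⌊R / r⌋ + 1 - ⌊-R / r⌋).toNat : ℝ) * r ≤ 2 * R + 3 := by
      have hle : ⌊-R / r⌋ ≤ ⌊R / r⌋ := by
        apply Int.floor_le_floor; gcongr; linarith
      have hcast : ((⌊R / r⌋ + 1 - ⌊-R / r⌋).toNat : ℝ) = ⌊R / r⌋ + 1 - ⌊-R / r⌋ := by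
        have := Int.toNat_of_nonneg (show 0 ≤ ⌊R / r⌋ + 1 - ⌊-R / r⌋ by omega)
        exact_mod_cast congrArg (Int.cast (R := ℝ)) this
      have h1 := Int.floor_le (R / r)
      have h2 := Int.lt_floor_add_one (-R / r)
      rw [hcast]
      calc ((⌊R / r⌋ : ℝ) + 1 - ⌊-R / r⌋) * r ≤ (R / r + 1 - (-R / r - 1)) * r := by
            gcongr; linarith
        _ = 2 * R + 2 * r := by field_simp; ring
        _ ≤ 2 * R + 3 := by linarith
    calc (((T.filter (· ∈ cell '' K)).image pt).card : ℝ) * r ^ q ≤ (T.card : ℝ) * r ^ q := by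
          gcongr
      _ = (((⌊R / r⌋ + 1 - ⌊-R / r⌋).toNat : ℝ) * r) ^ q := by
          rw [hTcard, mul_pow]; push_cast; rfl
      _ ≤ _ := by gcongr
  · have hv : cell x ∈ T.filter (· ∈ cell '' K) :=
      Finset.mem_filter.2 ⟨hT x hx, x, hx, rfl⟩
    refine ⟨pt (cell x), Finset.mem_image_of_mem _ hv, ?_⟩
    have hcoord : ∀ i, |x i - pt (cell x) i| ≤ r := fun i => by
      have h := Int.abs_sub_lt_one_of_floor_eq_floor (congrFun (hpt _ hv) i).symm
      rw [← sub_div, abs_div, abs_of_pos hr, div_lt_one hr] at h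
      exact h.le
    rw [EuclideanSpace.dist_eq]
    apply Real.sqrt_le_iff.2 ⟨by positivity, ?_⟩
    calc ∑ i, dist (x i) (pt (cell x) i) ^ 2 ≤ ∑ _i : Fin q, r ^ 2 := by
          gcongr with i; exact hcoord i
      _ = q * r ^ 2 := by simp
      _ ≤ (q * r) ^ 2 := by
          rw [mul_pow]
          gcongr
          exact_mod_cast Nat.le_self_pow two_ne_zero q

/-- In a space of upper Ahlfors dimension `n`, the `r`-neighbourhood of a Lipschitz image of a
bounded subset of `ℝ^q` has measure `O(r^{n-q})`. -/
lemma exists_measure_thickening_image_le {M : Type*} [PseudoMetricSpace M] [MeasurableSpace M]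
    {vol : Measure M} {n q : ℕ} {C : ℝ} (hC : 0 ≤ C)
    (hvol : ∀ (x : M) (r : ℝ), 0 < r → vol (Metric.ball x r) ≤ ENNReal.ofReal (C * r ^ n))
    (hq : q ≤ n) {K : Set (EuclideanSpace ℝ (Fin q))} (hK : Bornology.IsBounded K)
    {f : EuclideanSpace ℝ (Fin q) → M} {L : NNReal} (hf : LipschitzOnWith L f K) :
    ∃ A : ℝ, 0 ≤ A ∧ ∀ r : ℝ, 0 < r → r ≤ 1 →
      vol (Metric.thickening r (f '' K)) ≤ ENNReal.ofReal (A * r ^ (n - q)) := by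
  obtain ⟨A, hA, hcov⟩ := exists_finset_cover_card_le hK
  refine ⟨A * (C * (1 + L * q) ^ n), by positivity, fun r hr hr1 => ?_⟩
  obtain ⟨t, htK, htcard, ht⟩ := hcov r hr hr1
  have hsub : Metric.thickening r (f '' K) ⊆ ⋃ c ∈ t, Metric.ball (f c) ((1 + L * q) * r) := by
    intro x hx
    obtain ⟨_, ⟨y, hy, rfl⟩, hxy⟩ := Metric.mem_thickening_iff.1 hx
    obtain ⟨c, hc, hyc⟩ := ht y hy
    refine mem_iUnion₂.2 ⟨c, hc, ?_⟩
    have h1 := hf.dist_le_mul y hy c (htK hc)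
    have h2 : (L : ℝ) * dist y c ≤ L * (q * r) := by gcongr
    rw [Metric.mem_ball]
    linarith [dist_triangle x (f y) (f c)]
  have hpow : r ^ n = r ^ q * r ^ (n - q) := by rw [← pow_add, Nat.add_sub_cancel' hq]
  calc vol (Metric.thickening r (f '' K))
      ≤ ∑ c ∈ t, vol (Metric.ball (f c) ((1 + L * q) * r)) :=
        (measure_mono hsub).trans (measure_biUnion_finset_le _ _)
    _ ≤ ∑ _c ∈ t, ENNReal.ofReal (C * ((1 + L * q) * r) ^ n) := by
        gcongr with c; exact hvol _ _ (by positivity)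
    _ = ENNReal.ofReal (t.card * (C * ((1 + L * q) * r) ^ n)) := by
        rw [Finset.sum_const, nsmul_eq_mul, ENNReal.ofReal_mul (Nat.cast_nonneg _),
          ENNReal.ofReal_natCast]
    _ = ENNReal.ofReal ((t.card * r ^ q) * ((C * (1 + L * q) ^ n) * r ^ (n - q))) := by
        rw [mul_pow, hpow]; ring_nf
    _ ≤ ENNReal.ofReal (A * (C * (1 + L * q) ^ n) * r ^ (n - q)) := by
        rw [mul_assoc A]; gcongr

/-- If the sublevel sets `{d < r}` have measure `O(r^s)`, then `d^{-p}` is integrable for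
`0 < p < s`. -/
lemma lintegral_rpow_neg_lt_top_of_measure_lt_le {α : Type*} [MeasurableSpace α] {μ : Measure α}
    [IsFiniteMeasure μ] {d : α → ℝ} (hd : Measurable d) (hd0 : ∀ x, 0 ≤ d x) {A p s : ℝ}
    (hp : 0 < p) (hps : p < s)
    (hμ : ∀ r : ℝ, 0 < r → r ≤ 1 → μ {x | d x < r} ≤ ENNReal.ofReal (A * r ^ s)) :
    ∫⁻ x, ENNReal.ofReal (d x ^ (-p)) ∂μ < ⊤ := by
  let S : ℕ → Set α := fun k => {x | d x < (1 / 2) ^ k}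
  let a : ℕ → ℝ := fun k => ((1 / 2 : ℝ) ^ (k + 2)) ^ (-p)
  have hS : ∀ k, MeasurableSet (S k) := fun k => measurableSet_lt hd measurable_const
  have hpoint : ∀ x, ENNReal.ofReal (d x ^ (-p)) ≤
      1 + ∑' k, (S k).indicator (fun _ => ENNReal.ofReal (a k)) x := by
    intro x
    rcases (hd0 x).eq_or_lt with h0 | h0
    · simp [← h0, Real.zero_rpow (neg_ne_zero.2 hp.ne')]
    rcases le_or_gt 1 (d x) with h1 | h1
    · refine le_add_right ?_
      rw [ENNReal.ofReal_le_one]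
      exact Real.rpow_le_one_of_one_le_of_nonpos h1 (by linarith)
    · obtain ⟨k, hk, hk'⟩ : ∃ k, x ∈ S k ∧ (1 / 2 : ℝ) ^ (k + 2) ≤ d x := by
        obtain ⟨k, hk1, hk2⟩ := exists_nat_pow_near_of_lt_one h0 h1.le
          (by norm_num : (0 : ℝ) < 1 / 2) (by norm_num)
        rcases k with _ | k
        · exact ⟨0, by simpa [S] using h1, by norm_num at hk1 ⊢; linarith⟩
        · refine ⟨k, hk2.trans_lt ?_, hk1.le⟩
          exact pow_lt_pow_right_of_lt_one₀ (by norm_num) (by norm_num) k.lt_succ_self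
      calc ENNReal.ofReal (d x ^ (-p)) ≤ ENNReal.ofReal (a k) :=
            ENNReal.ofReal_le_ofReal
              (Real.rpow_le_rpow_of_nonpos (by positivity) hk' (by linarith))
        _ = (S k).indicator (fun _ => ENNReal.ofReal (a k)) x := by
            rw [indicator_of_mem hk]
        _ ≤ ∑' k, (S k).indicator (fun _ => ENNReal.ofReal (a k)) x :=
            ENNReal.le_tsum (f := fun k => (S k).indicator (fun _ => ENNReal.ofReal (a k)) x) k
        _ ≤ _ := le_add_left le_rfl
  have hterm : ∀ k, a k * (A * ((1 / 2 : ℝ) ^ k) ^ s) =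
      ((1 / 2 : ℝ) ^ 2) ^ (-p) * A * ((1 / 2 : ℝ) ^ (s - p)) ^ k := by
    intro k
    have h : ((1 / 2 : ℝ) ^ (s - p)) ^ k = ((1 / 2 : ℝ) ^ k) ^ (-p) * ((1 / 2 : ℝ) ^ k) ^ s := by
      rw [← Real.rpow_add (by positivity), Real.rpow_pow_comm (by positivity)]
      ring_nf
    simp only [a]
    rw [h, pow_add, Real.mul_rpow (by positivity) (by positivity)]
    ring
  have hsum : Summable fun k => a k * (A * ((1 / 2 : ℝ) ^ k) ^ s) := by
    simp_rw [hterm]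
    exact (summable_geometric_of_lt_one (by positivity)
      (Real.rpow_lt_one (by norm_num) (by norm_num) (by linarith))).mul_left _
  calc ∫⁻ x, ENNReal.ofReal (d x ^ (-p)) ∂μ
      ≤ ∫⁻ x, 1 + ∑' k, (S k).indicator (fun _ => ENNReal.ofReal (a k)) x ∂μ :=
        lintegral_mono hpoint
    _ = μ univ + ∑' k, ENNReal.ofReal (a k) * μ (S k) := by
        rw [lintegral_add_left measurable_const, lintegral_tsum fun k =>
          (measurable_const.indicator (hS k)).aemeasurable]
        simp_rw [lintegral_indicator_const (hS _), lintegral_one]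
    _ ≤ μ univ + ∑' k, ENNReal.ofReal (a k * (A * ((1 / 2 : ℝ) ^ k) ^ s)) := by
        gcongr with k
        rw [ENNReal.ofReal_mul (by positivity)]
        gcongr
        exact hμ _ (by positivity) (pow_le_one₀ (by norm_num) (by norm_num))
    _ < ⊤ := ENNReal.add_lt_top.2 ⟨measure_lt_top _ _, hsum.tsum_ofReal_lt_top⟩

/-- **Lemma (integrability of negative powers of the distance).** Let `(M, g)` be a
smooth, compact Riemannian manifold of dimension `n`, with geodesic distance `dist`
and Riemannian volume measure `vol` (so that `vol` is finite and small metric balls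
satisfy the upper `n`-dimensional volume bound `vol(B_r(x)) ≤ C r^n`). If `X ⊂ M` is
contained in a finite union of Lipschitz submanifolds of dimension `q` (here: a
finite union of images of compact subsets of `ℝ^q` under Lipschitz maps), then
`∫_M dist(·, X)^{-p} vol_g < +∞` for every `p ∈ [1, n - q)`. -/
theorem lemma_distanceW1p
    (M : Type) [MetricSpace M] [CompactSpace M]
    [MeasurableSpace M] [BorelSpace M]
    (n : ℕ) (vol : Measure M) [IsFiniteMeasure vol]
    (hAhlfors : ∃ C : ℝ, 0 < C ∧ ∀ (x : M) (r : ℝ), 0 < r → r ≤ 1 →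
      vol (Metric.ball x r) ≤ ENNReal.ofReal (C * r ^ n))
    (q : ℕ) (hq : q < n)
    (X : Set M)
    (hX : ∃ (N : ℕ) (f : Fin N → EuclideanSpace ℝ (Fin q) → M)
        (K : Fin N → Set (EuclideanSpace ℝ (Fin q))) (L : Fin N → NNReal),
      (∀ i, IsCompact (K i)) ∧ (∀ i, LipschitzOnWith (L i) (f i) (K i)) ∧
      X ⊆ ⋃ i, f i '' K i)
    (p : ℝ) (hp1 : 1 ≤ p) (hpn : p < (n : ℝ) - (q : ℝ)) :
    ∫⁻ x, ENNReal.ofReal (Metric.infDist x X ^ (-p)) ∂vol < ⊤ := by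
  rcases X.eq_empty_or_nonempty with rfl | hXne
  · simp [Real.zero_rpow (show -p ≠ 0 by linarith)]
  obtain ⟨C, hC, hball⟩ := hAhlfors
  obtain ⟨N, f, K, L, hK, hf, hXsub⟩ := hX
  have hvol : ∀ (x : M) (r : ℝ), 0 < r →
      vol (Metric.ball x r) ≤ ENNReal.ofReal ((C + vol.real univ) * r ^ n) := by
    intro x r hr
    rcases le_or_gt r 1 with h1 | h1
    · refine (hball x r hr h1).trans (ENNReal.ofReal_le_ofReal ?_)
      gcongr
      exact le_add_of_nonneg_right measureReal_nonneg
    · refine (measure_mono (subset_univ _)).trans ?_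
      rw [← ofReal_measureReal (measure_ne_top _ _)]
      refine ENNReal.ofReal_le_ofReal ?_
      calc vol.real univ ≤ (C + vol.real univ) * 1 := by linarith
        _ ≤ _ := by
          gcongr
          exact one_le_pow₀ h1.le
  choose A hA hAvol using fun i => exists_measure_thickening_image_le
    (by positivity : 0 ≤ C + vol.real univ) hvol hq.le (hK i).isBounded (hf i)
  refine lintegral_rpow_neg_lt_top_of_measure_lt_le (s := (n : ℝ) - q) (A := ∑ i, A i)
    (Metric.continuous_infDist_pt X).measurable (fun _ => Metric.infDist_nonneg)
    (by linarith) hpn fun r hr hr1 => ?_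
  have hsub : {x | Metric.infDist x X < r} ⊆ ⋃ i, Metric.thickening r (f i '' K i) := by
    intro x hx
    obtain ⟨y, hy, hxy⟩ := (Metric.infDist_lt_iff hXne).1 hx
    obtain ⟨i, hi⟩ := mem_iUnion.1 (hXsub hy)
    exact mem_iUnion.2 ⟨i, Metric.mem_thickening_iff.2 ⟨y, hi, hxy⟩⟩
  calc vol {x | Metric.infDist x X < r} ≤ ∑ i, vol (Metric.thickening r (f i '' K i)) :=
        (measure_mono hsub).trans (measure_iUnion_fintype_le _ _)
    _ ≤ ∑ i, ENNReal.ofReal (A i * r ^ (n - q)) := by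
        gcongr with i; exact hAvol i r hr hr1
    _ = ENNReal.ofReal ((∑ i, A i) * r ^ ((n : ℝ) - q)) := by
        rw [← ENNReal.ofReal_sum_of_nonneg fun i _ => mul_nonneg (hA i) (by positivity),
          ← Finset.sum_mul, ← Nat.cast_sub hq.le, Real.rpow_natCast]
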